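/- Let (P₊^t)_{t≥0} be a Markov contraction semigroup on the bounded functions on ℝ^d with generator L₊, and (P₋^t)_{t≥0} a Markov contraction semigroup on the bounded functions on ℝ^n with generator L₋. Let f̃ : ℝ^d × ℝ^n → ℝ be bounded such that: for every x₂ ∈ ℝ^n, f̃(·,x₂) ∈ D(L₊); for every x₁ ∈ ℝ^d, f̃(x₁,·) ∈ D(L₋); and, writing (L₊f̃)(x₁,x₂) := L₊( f̃(·,x₂) )(x₁) and (L₋f̃)(x₁,x₂) := L₋( f̃(x₁,·) )(x₂), one has (L₊f̃)(x₁,x₂) + (L₋f̃)(x₁,x₂) = 0 for all (x₁,x₂). Assume moreover the commutation property: for every s ≥ 0, the function x ↦ P₋^s( f̃(x,·) )(0) belongs to D(L₊) and L₊[ x ↦ P₋^s( f̃(x,·) )(0) ] is the function x ↦ P₋^s( (L₊f̃)(x,·) )(0). Define ψ : ℝ^d × ℝ → ℝ by ψ(x,t) := P₊^t( f̃(·,0) )(x) for t ≥ 0 and ψ(x,t) := P₋^{−t}( f̃(x,·) )(0) for t < 0. Then for every t ∈ ℝ the function ψ(·,t) belongs to D(L₊), and for every x ∈ ℝ^d the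 map t ↦ ψ(x,t) is differentiable on all of ℝ with ∂_t ψ(x,t) = L₊( ψ(·,t) )(x). -/

import Mathlib

open MeasureTheory Filter Topology
open scoped ENNReal

noncomputable section

instance : Fact ((1:ℝ≥0∞) ≤ ⊤) := ⟨le_top⟩

abbrev BddFun (α : Type) : Type := lp (fun _ : α => ℝ) ⊤

structure MarkovSemigroup (α : Type) where
  P : ℝ → BddFun α →ₗ[ℝ] BddFun α
  id_zero : P 0 = LinearMap.id
  comp' : ∀ s t : ℝ, 0 ≤ s → 0 ≤ t → P (s + t) = (P s).comp (P t)
  pos' : ∀ t : ℝ, 0 ≤ t → ∀ f : BddFun α, (∀ x, 0 ≤ f x) → ∀ x, 0 ≤ (P t f) x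
  contract' : ∀ t : ℝ, 0 ≤ t → ∀ f : BddFun α, ‖P t f‖ ≤ ‖f‖

def genLimit {α : Type} (S : MarkovSemigroup α) (f g : BddFun α) : Prop :=
  Tendsto (fun h : ℝ => h⁻¹ • (S.P h f - f)) (nhdsWithin 0 (Set.Ioi 0)) (nhds g)

def memDom {α : Type} (S : MarkovSemigroup α) (f : BddFun α) : Prop :=
  ∃ g, genLimit S f g

open scoped Classical in
noncomputable def MarkovSemigroup.gen {α : Type} (S : MarkovSemigroup α) (f : BddFun α) :
    BddFun α :=
  if h : memDom S f then h.choose else 0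

def memB0 {α : Type} (S : MarkovSemigroup α) (f : BddFun α) : Prop :=
  Tendsto (fun t : ℝ => S.P t f) (nhdsWithin 0 (Set.Ioi 0)) (nhds f)

def memDomIter {α : Type} (S : MarkovSemigroup α) : ℕ → BddFun α → Prop
  | 0, f => memB0 S f
  | n+1, f => memDomIter S n f ∧ memDom S (S.gen^[n] f)

namespace MarkovSemigroup

variable {α : Type} (S : MarkovSemigroup α)

theorem genLimit_gen {f : BddFun α} (h : memDom S f) : genLimit S f (S.gen f) := by
  unfold MarkovSemigroup.gen
  rw [dif_pos h]
  exact h.choose_spec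

theorem gen_eq {f g : BddFun α} (h : genLimit S f g) : S.gen f = g :=
  tendsto_nhds_unique (S.genLimit_gen ⟨g, h⟩) h

theorem P_add {s t : ℝ} (hs : 0 ≤ s) (ht : 0 ≤ t) (f : BddFun α) :
    S.P (s + t) f = S.P s (S.P t f) := by
  rw [S.comp' s t hs ht]; rfl

theorem tendsto_P {ι : Type*} {l : Filter ι} {t : ℝ} (ht : 0 ≤ t) {u : ι → BddFun α}
    {f : BddFun α} (h : Tendsto u l (𝓝 f)) :
    Tendsto (fun i => S.P t (u i)) l (𝓝 (S.P t f)) := by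
  rw [tendsto_iff_norm_sub_tendsto_zero] at h ⊢
  refine squeeze_zero (fun _ => norm_nonneg _) (fun i => ?_) h
  rw [← map_sub]
  exact S.contract' t ht _

theorem P_comm {s t : ℝ} (hs : 0 ≤ s) (ht : 0 ≤ t) (f : BddFun α) :
    S.P s (S.P t f) = S.P t (S.P s f) := by
  rw [← S.P_add hs ht, add_comm, S.P_add ht hs]

theorem genLimit_P {t : ℝ} (ht : 0 ≤ t) {f g : BddFun α} (h : genLimit S f g) :
    genLimit S (S.P t f) (S.P t g) := by
  refine (S.tendsto_P ht h).congr' ?_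
  filter_upwards [self_mem_nhdsWithin] with r hr
  rw [map_smul, map_sub, S.P_comm (le_of_lt hr) ht]

theorem memB0_of_genLimit {f g : BddFun α} (h : genLimit S f g) : memB0 S f := by
  have hid : Tendsto (fun r : ℝ => r) (𝓝[>] 0) (𝓝 0) := tendsto_id.mono_left nhdsWithin_le_nhds
  have h1 := (hid.smul h).add_const f
  rw [zero_smul, zero_add] at h1
  refine h1.congr' ?_
  filter_upwards [self_mem_nhdsWithin] with r hr
  rw [smul_inv_smul₀ (ne_of_gt hr), sub_add_cancel]

theorem memB0_P {t : ℝ} (ht : 0 ≤ t) {f : BddFun α} (h : memB0 S f) : memB0 S (S.P t f) := by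
  refine (S.tendsto_P ht h).congr' ?_
  filter_upwards [self_mem_nhdsWithin] with r hr
  rw [S.P_comm (le_of_lt hr) ht]

theorem memB0_of_tendsto {ι : Type*} {l : Filter ι} [l.NeBot] {u : ι → BddFun α} {g : BddFun α}
    (hu : ∀ᶠ i in l, memB0 S (u i)) (h : Tendsto u l (𝓝 g)) : memB0 S g := by
  rw [memB0, Metric.tendsto_nhds]
  intro ε hε
  obtain ⟨i, hi, hd⟩ := (hu.and (Metric.tendsto_nhds.1 h (ε / 3) (by positivity))).exists
  filter_upwards [self_mem_nhdsWithin, Metric.tendsto_nhds.1 hi (ε / 3) (by positivity)]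
    with t ht htd
  have h1 : dist (S.P t g) (S.P t (u i)) ≤ dist g (u i) := by
    rw [dist_eq_norm, dist_eq_norm, ← map_sub]
    exact S.contract' t (le_of_lt ht) _
  have h2 := dist_triangle4 (S.P t g) (S.P t (u i)) (u i) g
  rw [dist_comm g] at h1
  linarith

theorem memB0_of_genLimit_right {f g : BddFun α} (h : genLimit S f g) : memB0 S g := by
  have hf := S.memB0_of_genLimit h
  refine S.memB0_of_tendsto ?_ h
  filter_upwards [self_mem_nhdsWithin] with r hr
  have h1 := ((S.memB0_P (le_of_lt hr) hf).sub hf).const_smul r⁻¹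
  refine h1.congr fun t => ?_
  rw [map_smul, map_sub]

theorem hasDerivWithinAt_Ici {f g : BddFun α} (h : genLimit S f g) {t : ℝ} (ht : 0 ≤ t) :
    HasDerivWithinAt (fun s => S.P s f) (S.P t g) (Set.Ici t) t := by
  rw [← hasDerivWithinAt_Ioi_iff_Ici, hasDerivWithinAt_iff_tendsto_slope' (by simp)]
  have hsub : Tendsto (fun s : ℝ => s - t) (𝓝[>] t) (𝓝[>] 0) := by
    refine tendsto_nhdsWithin_iff.2 ⟨?_, ?_⟩
    · exact ((continuous_sub_right t).tendsto' t 0 (sub_self t)).mono_left nhdsWithin_le_nhds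
    · filter_upwards [self_mem_nhdsWithin] with s hs using Set.mem_Ioi.2 (sub_pos.2 hs)
  refine (S.tendsto_P ht (h.comp hsub)).congr' ?_
  filter_upwards [self_mem_nhdsWithin] with s hs
  have hs' : 0 ≤ s - t := le_of_lt (sub_pos.2 hs)
  simp only [Function.comp_apply]
  rw [map_smul, map_sub, ← S.P_add ht hs', add_sub_cancel, slope_def_module]

theorem hasDerivWithinAt_Iic {f g : BddFun α} (h : genLimit S f g) {t : ℝ} (ht : 0 < t) :
    HasDerivWithinAt (fun s => S.P s f) (S.P t g) (Set.Iic t) t := by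
  rw [← hasDerivWithinAt_Iio_iff_Iic, hasDerivWithinAt_iff_tendsto_slope' (by simp)]
  have hsub : Tendsto (fun s : ℝ => t - s) (𝓝[<] t) (𝓝[>] 0) := by
    refine tendsto_nhdsWithin_iff.2 ⟨?_, ?_⟩
    · exact ((continuous_const.sub continuous_id).tendsto' t 0 (sub_self t)).mono_left
        nhdsWithin_le_nhds
    · filter_upwards [self_mem_nhdsWithin] with s hs using Set.mem_Ioi.2 (sub_pos.2 hs)
  have h1 := (h.comp hsub).sub ((S.memB0_of_genLimit_right h).comp hsub)
  rw [sub_self] at h1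
  have h2 := tendsto_zero_iff_norm_tendsto_zero.1 h1
  rw [tendsto_iff_norm_sub_tendsto_zero]
  refine squeeze_zero' (Eventually.of_forall fun _ => norm_nonneg _) ?_ h2
  filter_upwards [self_mem_nhdsWithin, mem_nhdsWithin_of_mem_nhds (lt_mem_nhds ht)] with s hs hs0
  have hs' : 0 ≤ t - s := le_of_lt (sub_pos.2 hs)
  have key : slope (fun s => S.P s f) t s - S.P t g =
      S.P s ((t - s)⁻¹ • (S.P (t - s) f - f) - S.P (t - s) g) := by
    rw [map_sub, map_smul, map_sub, ← S.P_add hs0.le hs', ← S.P_add hs0.le hs', add_sub_cancel,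
      slope_comm, slope_def_module]
  rw [key]
  exact S.contract' s hs0.le _

theorem hasDerivAt {f g : BddFun α} (h : genLimit S f g) {t : ℝ} (ht : 0 < t) :
    HasDerivAt (fun s => S.P s f) (S.P t g) t := by
  have := (S.hasDerivWithinAt_Iic h ht).union (S.hasDerivWithinAt_Ici h ht.le)
  rwa [Set.Iic_union_Ici, hasDerivWithinAt_univ] at this

end MarkovSemigroup

namespace BddFun

variable {α : Type}

/-- Evaluation at a point, as a continuous linear functional on bounded functions. -/
def evalCLM (x : α) : BddFun α →L[ℝ] ℝ :=
  LinearMap.mkContinuous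
    { toFun := fun f => f x
      map_add' := fun _ _ => rfl
      map_smul' := fun _ _ => rfl } 1 fun f => by
    rw [one_mul]; exact lp.norm_apply_le_norm ENNReal.top_ne_zero f x

theorem hasDerivWithinAt_apply {u : ℝ → BddFun α} {u' : BddFun α} {s : Set ℝ} {t : ℝ}
    (h : HasDerivWithinAt u u' s t) (x : α) :
    HasDerivWithinAt (fun r => u r x) (u' x) s t :=
  (evalCLM x).hasFDerivAt.comp_hasDerivWithinAt t h

end BddFun


theorem stmt_16 (d n : ℕ) (hd : 1 ≤ d) (hn : 1 ≤ n)
    (Sp : MarkovSemigroup (Fin d → ℝ)) (Sm : MarkovSemigroup (Fin n → ℝ))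
    (ft : (Fin n → ℝ) → BddFun (Fin d → ℝ))
    (fs : (Fin d → ℝ) → BddFun (Fin n → ℝ))
    (hcompat : ∀ x y, (ft y) x = (fs x) y)
    (hbdd : ∃ C : ℝ, ∀ x y, |(ft y) x| ≤ C)
    (hdomp : ∀ y, memDom Sp (ft y))
    (hdomm : ∀ x, memDom Sm (fs x))
    (hzero : ∀ x y, (Sp.gen (ft y)) x + (Sm.gen (fs x)) y = 0)
    (gslice : (Fin d → ℝ) → BddFun (Fin n → ℝ))
    (hgslice : ∀ x y, (gslice x) y = (Sp.gen (ft y)) x)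
    (hcomm : ∀ s : ℝ, 0 ≤ s → ∃ ψ : BddFun (Fin d → ℝ),
      (∀ x, ψ x = (Sm.P s (fs x)) 0) ∧ memDom Sp ψ ∧
        ∀ x, (Sp.gen ψ) x = (Sm.P s (gslice x)) 0)
    (Ψ : ℝ → BddFun (Fin d → ℝ))
    (hΨpos : ∀ t : ℝ, 0 ≤ t → Ψ t = Sp.P t (ft 0))
    (hΨneg : ∀ t : ℝ, t < 0 → ∀ x, (Ψ t) x = (Sm.P (-t) (fs x)) 0) :
    (∀ t : ℝ, memDom Sp (Ψ t)) ∧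
      ∀ x, ∀ t : ℝ, HasDerivAt (fun s => (Ψ s) x) ((Sp.gen (Ψ t)) x) t := by
  have hg : ∀ x, Sm.gen (fs x) = -gslice x := by
    intro x
    ext y
    rw [lp.coeFn_neg, Pi.neg_apply, hgslice]
    linarith [hzero x y]
  have hposlim : ∀ t, 0 ≤ t → genLimit Sp (Ψ t) (Sp.P t (Sp.gen (ft 0))) := by
    intro t ht
    rw [hΨpos t ht]
    exact Sp.genLimit_P ht (Sp.genLimit_gen (hdomp 0))
  have hneg : ∀ t, t < 0 → memDom Sp (Ψ t) ∧
      ∀ x, (Sp.gen (Ψ t)) x = (Sm.P (-t) (gslice x)) 0 := by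
    intro t ht
    obtain ⟨ψ, h1, h2, h3⟩ := hcomm (-t) (by linarith)
    have : Ψ t = ψ := by
      ext x
      rw [h1, hΨneg t ht]
    rw [this]
    exact ⟨h2, h3⟩
  have hback : ∀ x, ∀ t ≤ 0, (Ψ t) x = (Sm.P (-t) (fs x)) 0 := by
    intro x t ht
    rcases ht.lt_or_eq with h | rfl
    · exact hΨneg t h x
    · rw [hΨpos 0 le_rfl, neg_zero, Sp.id_zero, Sm.id_zero]
      exact hcompat x 0
  refine ⟨fun t => ?_, fun x t => ?_⟩
  · rcases lt_or_ge t 0 with ht | ht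
    · exact (hneg t ht).1
    · exact ⟨_, hposlim t ht⟩
  have hmlim : genLimit Sm (fs x) (-gslice x) := hg x ▸ Sm.genLimit_gen (hdomm x)
  have hplim := Sp.genLimit_gen (hdomp 0)
  rcases lt_trichotomy t 0 with ht | rfl | ht
  · rw [(hneg t ht).2 x]
    have h1 := BddFun.hasDerivWithinAt_apply
      (Sm.hasDerivAt hmlim (neg_pos.2 ht)).hasDerivWithinAt (s := Set.univ) 0
    rw [hasDerivWithinAt_univ] at h1
    have h2 := h1.scomp t (hasDerivAt_neg t)
    rw [map_neg, lp.coeFn_neg, Pi.neg_apply, neg_smul, one_smul, neg_neg] at h2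
    refine h2.congr_of_eventuallyEq ?_
    filter_upwards [gt_mem_nhds ht] with s hs using hback x s hs.le
  · have hr := BddFun.hasDerivWithinAt_apply (Sp.hasDerivWithinAt_Ici hplim le_rfl) x
    have hr' := hr.congr (f₁ := fun s => (Ψ s) x) (fun s hs => by rw [hΨpos s hs])
      (by rw [hΨpos 0 le_rfl])
    have hl := BddFun.hasDerivWithinAt_apply (Sm.hasDerivWithinAt_Ici hmlim le_rfl) 0
    rw [← neg_zero (G := ℝ)] at hl
    have hl2 := HasDerivWithinAt.scomp (0 : ℝ) (t' := Set.Ici (-0)) hl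
      (hasDerivAt_neg (0 : ℝ)).hasDerivWithinAt
      (s := Set.Iic 0) (fun s hs => Set.mem_Ici.2 (neg_le_neg hs))
    have hl' := hl2.congr (f₁ := fun s => (Ψ s) x) (fun s hs => hback x s hs) (hback x 0 le_rfl)
    rw [map_neg, lp.coeFn_neg, Pi.neg_apply, neg_smul, one_smul, neg_neg, neg_zero, Sm.id_zero,
      LinearMap.id_apply, hgslice] at hl'
    rw [Sp.gen_eq (hposlim 0 le_rfl)]
    rw [Sp.id_zero, LinearMap.id_apply] at hr' ⊢
    have := hl'.union hr'
    rwa [Set.Iic_union_Ici, hasDerivWithinAt_univ] at this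
  · rw [Sp.gen_eq (hposlim t ht.le)]
    have h1 := BddFun.hasDerivWithinAt_apply
      (Sp.hasDerivAt hplim ht).hasDerivWithinAt (s := Set.univ) x
    rw [hasDerivWithinAt_univ] at h1
    refine h1.congr_of_eventuallyEq ?_
    filter_upwards [lt_mem_nhds ht] with s hs
    rw [hΨpos s hs.le]
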